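/- arXiv:0810.3225 — 4 statements merged into one kernel-verified Lean document; each statement's English description precedes it below -/
import Mathlib

section
/- If g ∈ Γ is a nontrivial element fixing some nonzero vector v ∈ ℂ⁴ (i.e. g·v = v, v ≠ 0, g ≠ 1), then g has order 3. In particular, the quaternion normal subgroup Q₈ ⊂ Γ acts freely on ℂ⁴ ∖ {0}. -/
/-!
STATEMENT 13: If g ∈ Γ is a nontrivial element fixing some nonzero vector v ∈ ℂ⁴,
then g has order 3. In particular, the quaternion normal subgroup Q₈ ⊂ Γ (the
image of Q₈ = ⟨I, J⟩ ⊂ SU(2), acting diagonally) acts freely on ℂ⁴ ∖ {0}.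
-/

noncomputable section

open Matrix

/-- ω = e^{2πi/3} -/
noncomputable def ω : ℂ := Complex.exp (2 * Real.pi * Complex.I / 3)

/-- I₂ = [[i,0],[0,-i]] -/
def I₂ : Matrix (Fin 2) (Fin 2) ℂ := !![Complex.I, 0; 0, -Complex.I]

/-- J₂ = [[0,1],[-1,0]] -/
def J₂ : Matrix (Fin 2) (Fin 2) ℂ := !![0, 1; -1, 0]

/-- τ = -(1/2)·[[1+i, -1+i],[1+i, 1-i]] -/
def τ : Matrix (Fin 2) (Fin 2) ℂ :=
  -(1 / 2 : ℂ) • !![1 + Complex.I, -1 + Complex.I; 1 + Complex.I, 1 - Complex.I]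

/-- the block-diagonal 4×4 matrix A ⊕ D -/
def blockDiag (A D : Matrix (Fin 2) (Fin 2) ℂ) : Matrix (Fin 4) (Fin 4) ℂ :=
  Matrix.reindex finSumFinEquiv finSumFinEquiv (Matrix.fromBlocks A 0 0 D)

/-- g₁ = I₂ ⊕ ((I₂)ᵀ)⁻¹ -/
noncomputable def g₁ : Matrix (Fin 4) (Fin 4) ℂ := blockDiag I₂ ((I₂ᵀ)⁻¹)

/-- g₂ = (ωτ) ⊕ (((ωτ)ᵀ)⁻¹) -/
noncomputable def g₂ : Matrix (Fin 4) (Fin 4) ℂ := blockDiag (ω • τ) (((ω • τ)ᵀ)⁻¹)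

/-- gJ = J₂ ⊕ ((J₂)ᵀ)⁻¹, the image of the quaternion J -/
noncomputable def gJ : Matrix (Fin 4) (Fin 4) ℂ := blockDiag J₂ ((J₂ᵀ)⁻¹)

/-- `M` is `A ⊕ conj A` with `A` unitary and `(det A)^n = 1`. -/
def IsGood (n : ℕ) (M : Matrix (Fin 4) (Fin 4) ℂ) : Prop :=
  ∃ A : Matrix (Fin 2) (Fin 2) ℂ, Aᴴ * A = 1 ∧ A.det ^ n = 1 ∧ M = blockDiag A (A.map star)

lemma blockDiag_mul (A B C D : Matrix (Fin 2) (Fin 2) ℂ) :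
    blockDiag A B * blockDiag C D = blockDiag (A * C) (B * D) := by
  simp [_root_.blockDiag, Matrix.submatrix_mul_equiv, Matrix.fromBlocks_multiply]

lemma blockDiag_one : blockDiag 1 1 = 1 := by
  simp [_root_.blockDiag]

lemma map_star_mul (A B : Matrix (Fin 2) (Fin 2) ℂ) :
    (A * B).map star = A.map star * B.map star := by
  ext i j
  simp [Matrix.mul_apply]

lemma map_star_one : (1 : Matrix (Fin 2) (Fin 2) ℂ).map star = 1 := by
  simp

lemma transpose_inv_eq {A : Matrix (Fin 2) (Fin 2) ℂ} (h : Aᴴ * A = 1) :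
    (Aᵀ)⁻¹ = A.map star := by
  apply Matrix.inv_eq_right_inv
  have h2 := congrArg Matrix.transpose h
  rw [Matrix.transpose_mul, Matrix.transpose_one] at h2
  exact h2

lemma isGood_of {n : ℕ} {A : Matrix (Fin 2) (Fin 2) ℂ} (h : Aᴴ * A = 1) (hd : A.det ^ n = 1) :
    IsGood n (blockDiag A ((Aᵀ)⁻¹)) :=
  ⟨A, h, hd, by rw [transpose_inv_eq h]⟩

lemma isGood_closure {n : ℕ} {S : Set (GL (Fin 4) ℂ)}
    (hS : ∀ g ∈ S, IsGood n (g : Matrix (Fin 4) (Fin 4) ℂ)) (g : GL (Fin 4) ℂ)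
    (hg : g ∈ Subgroup.closure S) : IsGood n (g : Matrix (Fin 4) (Fin 4) ℂ) := by
  induction hg using Subgroup.closure_induction with
  | mem x hx => exact hS x hx
  | one => exact ⟨1, by simp, by simp, by rw [map_star_one, blockDiag_one]; rfl⟩
  | mul x y _ _ hx hy =>
    obtain ⟨A, hA, hAd, hAx⟩ := hx
    obtain ⟨B, hB, hBd, hBy⟩ := hy
    refine ⟨A * B, ?_, ?_, ?_⟩
    · rw [Matrix.conjTranspose_mul, Matrix.mul_assoc, ← Matrix.mul_assoc Aᴴ, hA, Matrix.one_mul, hB]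
    · rw [Matrix.det_mul, mul_pow, hAd, hBd, one_mul]
    · rw [Units.val_mul, hAx, hBy, blockDiag_mul, map_star_mul]
  | inv x _ hx =>
    obtain ⟨A, hA, hAd, hAx⟩ := hx
    have hA' : A * Aᴴ = 1 := mul_eq_one_comm.mp hA
    refine ⟨Aᴴ, ?_, ?_, ?_⟩
    · rw [Matrix.conjTranspose_conjTranspose, hA']
    · rw [Matrix.det_conjTranspose, ← star_pow, hAd, star_one]
    · apply Units.inv_eq_of_mul_eq_one_right
      rw [hAx, blockDiag_mul, ← map_star_mul, hA', map_star_one, blockDiag_one]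

lemma omega_cube : ω ^ 3 = 1 := by
  rw [ω, ← Complex.exp_nat_mul, ← Complex.exp_two_pi_mul_I]
  congr 1
  push_cast
  ring

lemma star_omega_mul : star ω * ω = 1 := by
  have h : ‖ω‖ = 1 := Complex.norm_eq_one_of_pow_eq_one omega_cube (by norm_num)
  have := Complex.conj_mul' ω
  rw [h] at this
  simpa using this

lemma I_unitary : I₂ᴴ * I₂ = 1 := by
  ext i j
  fin_cases i <;> fin_cases j <;> simp [I₂, Matrix.mul_apply, Fin.sum_univ_two]

lemma J_unitary : J₂ᴴ * J₂ = 1 := by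
  ext i j
  fin_cases i <;> fin_cases j <;> simp [J₂, Matrix.mul_apply, Fin.sum_univ_two]

lemma tau_unitary : τᴴ * τ = 1 := by
  ext i j
  fin_cases i <;> fin_cases j <;> simp [τ, Matrix.mul_apply, Fin.sum_univ_two] <;>
    ring_nf <;> simp [map_ofNat] <;> norm_num

lemma I_det : I₂.det = 1 := by simp [I₂, Matrix.det_fin_two]

lemma J_det : J₂.det = 1 := by simp [J₂, Matrix.det_fin_two]

lemma tau_det : τ.det = 1 := by
  simp [τ, Matrix.det_fin_two]
  ring_nf
  simp
  try norm_num

lemma omega_tau_unitary : (ω • τ)ᴴ * (ω • τ) = 1 := by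
  rw [Matrix.conjTranspose_smul, Matrix.smul_mul, Matrix.mul_smul, smul_smul, star_omega_mul,
    one_smul, tau_unitary]

lemma omega_tau_det : (ω • τ).det ^ 3 = 1 := by
  rw [Matrix.det_smul, tau_det, mul_one, ← pow_mul, mul_comm, pow_mul, omega_cube, one_pow]

lemma blockDiag_mulVec (A B : Matrix (Fin 2) (Fin 2) ℂ) (v : Fin 4 → ℂ) :
    (blockDiag A B).mulVec v =
      Sum.elim (A.mulVec ![v 0, v 1]) (B.mulVec ![v 2, v 3]) ∘ finSumFinEquiv.symm := by
  have hv : v ∘ finSumFinEquiv = Sum.elim ![v 0, v 1] ![v 2, v 3] := by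
    funext i
    rcases i with i | i <;> fin_cases i <;> rfl
  rw [_root_.blockDiag, Matrix.reindex_apply, Matrix.submatrix_mulVec_equiv]
  simp only [Equiv.symm_symm]
  rw [hv, Matrix.fromBlocks_mulVec]
  simp

/-- A fixed vector of `A ⊕ conj A` forces `det (A - 1) = 0`. -/
lemma det_sub_one {A : Matrix (Fin 2) (Fin 2) ℂ} {v : Fin 4 → ℂ} (hv : v ≠ 0)
    (h : (blockDiag A (A.map star)).mulVec v = v) : (A - 1).det = 0 := by
  rw [blockDiag_mulVec] at h
  have h1 : A.mulVec ![v 0, v 1] = ![v 0, v 1] := by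
    funext i
    fin_cases i
    · exact congrFun h 0
    · exact congrFun h 1
  have h2 : (A.map star).mulVec ![v 2, v 3] = ![v 2, v 3] := by
    funext i
    fin_cases i
    · exact congrFun h 2
    · exact congrFun h 3
  have key : ∀ (B : Matrix (Fin 2) (Fin 2) ℂ) (u : Fin 2 → ℂ), u ≠ 0 → B.mulVec u = u →
      (B - 1).det = 0 := fun B u hu hB =>
    Matrix.exists_mulVec_eq_zero_iff.mp ⟨u, hu, by rw [Matrix.sub_mulVec, hB, Matrix.one_mulVec, sub_self]⟩
  by_cases hu : ![v 0, v 1] = 0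
  · by_cases hw : ![v 2, v 3] = 0
    · exfalso
      apply hv
      funext i
      fin_cases i
      · exact congrFun hu 0
      · exact congrFun hu 1
      · exact congrFun hw 0
      · exact congrFun hw 1
    · have := key _ _ hw h2
      have h3 : (A - 1).map star = A.map star - 1 := by
        ext i j
        fin_cases i <;> fin_cases j <;> simp
      have h4 : ((A - 1)ᴴ).det = 0 := by
        rw [← Matrix.det_transpose]
        change ((A - 1).map star).det = 0
        rw [h3, this]
      rw [Matrix.det_conjTranspose] at h4
      exact star_eq_zero.mp h4
  · exact key _ _ hu h1

/-- Cayley–Hamilton in the form needed here. -/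
lemma sub_mul_sub {A : Matrix (Fin 2) (Fin 2) ℂ} (h : (A - 1).det = 0) :
    (A - 1) * (A - A.det • (1 : Matrix (Fin 2) (Fin 2) ℂ)) = 0 := by
  rw [Matrix.det_fin_two] at h
  simp at h
  ext i j
  fin_cases i <;> fin_cases j <;>
    simp [Matrix.mul_apply, Fin.sum_univ_two, Matrix.det_fin_two] <;> grind

open scoped ComplexOrder in
/-- A unitary matrix with determinant one and eigenvalue one is trivial. -/
lemma eq_one_of_det_one {A : Matrix (Fin 2) (Fin 2) ℂ} (hA : Aᴴ * A = 1) (hd : A.det = 1)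
    (h : (A - 1).det = 0) : A = 1 := by
  have hA' : A * Aᴴ = 1 := mul_eq_one_comm.mp hA
  have h2 := sub_mul_sub h
  rw [hd, one_smul] at h2
  have h3 : (A - 1)ᴴ = -(Aᴴ * (A - 1)) := by
    rw [Matrix.mul_sub, hA]
    simp
  have h4 : (A - 1)ᴴ * (A - 1) = 0 := by
    rw [h3, Matrix.neg_mul, Matrix.mul_assoc, h2, Matrix.mul_zero, neg_zero]
  exact sub_eq_zero.mp (Matrix.conjTranspose_mul_self_eq_zero.mp h4)

lemma cube_eq_one {A : Matrix (Fin 2) (Fin 2) ℂ} (hd : A.det ^ 3 = 1) (hd1 : A.det ≠ 1)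
    (h : (A - 1).det = 0) : A ^ 3 = 1 := by
  have h2 := sub_mul_sub h
  generalize A.det = d at *
  have hq : d ^ 2 + d + 1 = 0 := by
    have : (d - 1) * (d ^ 2 + d + 1) = 0 := by linear_combination hd
    exact (mul_eq_zero.mp this).resolve_left (sub_ne_zero.mpr hd1)
  have e : A ^ 2 = (1 + d) • A - d • (1 : Matrix (Fin 2) (Fin 2) ℂ) := by
    have : (A - 1) * (A - d • (1 : Matrix (Fin 2) (Fin 2) ℂ)) =
      A ^ 2 - ((1 + d) • A - d • (1 : Matrix (Fin 2) (Fin 2) ℂ)) := by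
      simp only [sub_mul, mul_sub, one_mul, Matrix.mul_smul, mul_one, pow_two, add_smul, one_smul]
      abel
    rw [this] at h2
    exact sub_eq_zero.mp h2
  have e3 : A ^ 3 = (1 + d + d ^ 2) • A - (d + d ^ 2) • (1 : Matrix (Fin 2) (Fin 2) ℂ) := by
    rw [pow_succ, e, sub_mul, Matrix.smul_mul, ← pow_two, e, Matrix.smul_mul, one_mul]
    module
  rw [e3, show 1 + d + d ^ 2 = 0 by linear_combination hq,
    show d + d ^ 2 = -1 by linear_combination hq]
  simp

theorem nontrivial_stabilizers_have_order_three
    (G₁ G₂ GJ : GL (Fin 4) ℂ)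
    (hG₁ : (G₁ : Matrix (Fin 4) (Fin 4) ℂ) = g₁)
    (hG₂ : (G₂ : Matrix (Fin 4) (Fin 4) ℂ) = g₂)
    (hGJ : (GJ : Matrix (Fin 4) (Fin 4) ℂ) = gJ) :
    (∀ g ∈ Subgroup.closure {G₁, G₂}, g ≠ 1 →
      (∃ v : Fin 4 → ℂ, v ≠ 0 ∧ (g : Matrix (Fin 4) (Fin 4) ℂ).mulVec v = v) →
      orderOf g = 3) ∧
    (∀ g ∈ Subgroup.closure {G₁, GJ}, g ≠ 1 →
      ∀ v : Fin 4 → ℂ, v ≠ 0 → (g : Matrix (Fin 4) (Fin 4) ℂ).mulVec v ≠ v) := by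
  have hI3 : ∀ n, IsGood n (G₁ : Matrix (Fin 4) (Fin 4) ℂ) := fun n => by
    rw [hG₁]
    exact isGood_of I_unitary (by rw [I_det, one_pow])
  have h2 : IsGood 3 (G₂ : Matrix (Fin 4) (Fin 4) ℂ) := by
    rw [hG₂]
    exact isGood_of omega_tau_unitary omega_tau_det
  have hJ : IsGood 1 (GJ : Matrix (Fin 4) (Fin 4) ℂ) := by
    rw [hGJ]
    exact isGood_of J_unitary (by rw [J_det, one_pow])
  constructor
  · rintro g hg hg1 ⟨v, hv, hgv⟩
    obtain ⟨A, hA, hAd, hAg⟩ := isGood_closure (n := 3)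
      (by rintro x (rfl | rfl); exacts [hI3 3, h2]) g hg
    rw [hAg] at hgv
    have h0 := det_sub_one hv hgv
    have hd1 : A.det ≠ 1 := by
      intro hd
      apply hg1
      apply Units.ext
      rw [hAg, eq_one_of_det_one hA hd h0, map_star_one, blockDiag_one]
      rfl
    have h3 := cube_eq_one hAd hd1 h0
    have : Fact (Nat.Prime 3) := ⟨Nat.prime_three⟩
    refine orderOf_eq_prime ?_ hg1
    apply Units.ext
    rw [Units.val_pow_eq_pow_val, hAg, pow_succ, pow_two, blockDiag_mul, blockDiag_mul,
      ← map_star_mul, ← map_star_mul, ← pow_two, ← pow_succ, h3, map_star_one, blockDiag_one]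
    rfl
  · intro g hg hg1 v hv hgv
    obtain ⟨A, hA, hAd, hAg⟩ := isGood_closure (n := 1)
      (by rintro x (rfl | rfl); exacts [hI3 1, hJ]) g hg
    rw [hAg] at hgv
    have h0 := det_sub_one hv hgv
    apply hg1
    apply Units.ext
    rw [hAg, eq_one_of_det_one hA (by simpa using hAd) h0, map_star_one, blockDiag_one]
    rfl

end
end

section
/- Every element of order 3 in the group G₁ ⊂ GL(2,ℂ) generated by I₂ and ωτ has 1 as an eigenvalue (i.e. fixes a nonzero vector, and is therefore a complex reflection of order 3), and G₁ is generated by its elements of order 3. -/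
/-!
STATEMENT 14: Every element of order 3 in the group G₁ ⊂ GL(2,ℂ) generated by I₂
and ωτ has 1 as an eigenvalue (i.e. fixes a nonzero vector, and is therefore a
complex reflection of order 3), and G₁ is generated by its elements of order 3.
-/

noncomputable section

open Matrix

abbrev MM := Matrix (Fin 2) (Fin 2) ℂ

def qJ : MM := !![0, Complex.I; Complex.I, 0]

def qK : MM := !![0, -1; 1, 0]

def tT : MM := ω • τ

theorem omega_sq : ω ^ 2 = -1 - ω := by
  have h : IsPrimitiveRoot ω 3 := by
    have := Complex.isPrimitiveRoot_exp 3 (by norm_num)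
    simpa [ω] using this
  have := h.geom_sum_eq_zero (by norm_num)
  simp [Finset.sum_range_succ] at this
  linear_combination this

theorem I_sq' : Complex.I ^ 2 = -1 := Complex.I_sq

theorem tT_eq : tT = !![-(1/2) * ω * (1 + Complex.I), -(1/2) * ω * (-1 + Complex.I);
    -(1/2) * ω * (1 + Complex.I), -(1/2) * ω * (1 - Complex.I)] := by
  ext i j
  fin_cases i <;> fin_cases j <;> simp [tT, τ] <;> ring

theorem tT_sq : tT * tT = !![(1/2) * (-1 - ω) * (-1 + Complex.I), (1/2) * (-1 - ω) * (-1 + Complex.I);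
    (1/2) * (-1 - ω) * (1 + Complex.I), (1/2) * (-1 - ω) * (-1 - Complex.I)] := by
  have h1 := omega_sq
  have h2 := I_sq'
  rw [tT_eq]
  ext i j
  fin_cases i <;> fin_cases j <;> simp [Matrix.mul_apply, Fin.sum_univ_two] <;> grind

theorem tT_cube : tT * tT * tT = 1 := by
  have h1 := omega_sq
  have h2 := I_sq'
  rw [tT_sq, tT_eq]
  ext i j
  fin_cases i <;> fin_cases j <;> simp [Matrix.mul_apply, Fin.sum_univ_two] <;> grind

theorem tT_I : tT * I₂ = qJ * tT := by
  have h2 := I_sq'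
  rw [tT_eq]
  ext i j
  fin_cases i <;> fin_cases j <;> simp [I₂, qJ, Matrix.mul_apply, Fin.sum_univ_two] <;> grind

theorem tT_J : tT * qJ = qK * tT := by
  have h2 := I_sq'
  rw [tT_eq]
  ext i j
  fin_cases i <;> fin_cases j <;> simp [qK, qJ, Matrix.mul_apply, Fin.sum_univ_two] <;> grind

theorem q_II : I₂ * I₂ = -1 := by
  ext i j
  fin_cases i <;> fin_cases j <;> simp [I₂, Matrix.mul_apply, Fin.sum_univ_two]

theorem q_JJ : qJ * qJ = -1 := by
  ext i j
  fin_cases i <;> fin_cases j <;> simp [qJ, Matrix.mul_apply, Fin.sum_univ_two]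

theorem q_KK : qK * qK = -1 := by
  ext i j
  fin_cases i <;> fin_cases j <;> simp [qK, Matrix.mul_apply, Fin.sum_univ_two]

theorem q_IJ : I₂ * qJ = qK := by
  ext i j
  fin_cases i <;> fin_cases j <;> simp [I₂, qJ, qK, Matrix.mul_apply, Fin.sum_univ_two]

theorem q_JI : qJ * I₂ = -qK := by
  ext i j
  fin_cases i <;> fin_cases j <;> simp [I₂, qJ, qK, Matrix.mul_apply, Fin.sum_univ_two]

theorem q_JK : qJ * qK = I₂ := by
  ext i j
  fin_cases i <;> fin_cases j <;> simp [I₂, qJ, qK, Matrix.mul_apply, Fin.sum_univ_two]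

theorem q_KJ : qK * qJ = -I₂ := by
  ext i j
  fin_cases i <;> fin_cases j <;> simp [I₂, qJ, qK, Matrix.mul_apply, Fin.sum_univ_two]

theorem q_KI : qK * I₂ = qJ := by
  ext i j
  fin_cases i <;> fin_cases j <;> simp [I₂, qJ, qK, Matrix.mul_apply, Fin.sum_univ_two]

theorem q_IK : I₂ * qK = -qJ := by
  ext i j
  fin_cases i <;> fin_cases j <;> simp [I₂, qJ, qK, Matrix.mul_apply, Fin.sum_univ_two]

/-- Membership in the quaternion group Q₈. -/
def inQ (M : MM) : Prop :=
  M = 1 ∨ M = -1 ∨ M = I₂ ∨ M = -I₂ ∨ M = qJ ∨ M = -qJ ∨ M = qK ∨ M = -qK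

theorem inQ_I {M : MM} (h : inQ M) : inQ (M * I₂) := by
  rcases h with h | h | h | h | h | h | h | h <;> subst h <;>
    simp [inQ, q_II, q_JI, q_KI]

theorem inQ_J {M : MM} (h : inQ M) : inQ (M * qJ) := by
  rcases h with h | h | h | h | h | h | h | h <;> subst h <;>
    simp [inQ, q_IJ, q_JJ, q_KJ]

theorem inQ_K {M : MM} (h : inQ M) : inQ (M * qK) := by
  rcases h with h | h | h | h | h | h | h | h <;> subst h <;>
    simp [inQ, q_IK, q_JK, q_KK]

/-- Membership in Q₈ · ⟨ωτ⟩. -/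
def inG (M : MM) : Prop :=
  ∃ q, inQ q ∧ (M = q ∨ M = q * tT ∨ M = q * (tT * tT))

theorem inG_T {M : MM} (h : inG M) : inG (M * tT) := by
  obtain ⟨q, hq, h | h | h⟩ := h <;> subst h <;> refine ⟨_, hq, ?_⟩
  · simp
  · simp [Matrix.mul_assoc]
  · left
    rw [Matrix.mul_assoc, tT_cube, Matrix.mul_one]

theorem inG_I {M : MM} (h : inG M) : inG (M * I₂) := by
  obtain ⟨q, hq, h | h | h⟩ := h <;> subst h
  · exact ⟨_, inQ_I hq, Or.inl rfl⟩
  · refine ⟨_, inQ_J hq, Or.inr (Or.inl ?_)⟩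
    rw [Matrix.mul_assoc, tT_I, Matrix.mul_assoc]
  · refine ⟨_, inQ_K hq, Or.inr (Or.inr ?_)⟩
    calc q * (tT * tT) * I₂ = q * (tT * (tT * I₂)) := by simp only [Matrix.mul_assoc]
      _ = q * ((tT * qJ) * tT) := by rw [tT_I]; simp only [Matrix.mul_assoc]
      _ = _ := by rw [tT_J]; simp only [Matrix.mul_assoc]

theorem fix_of_det {N : MM} (h : (N - 1).det = 0) :
    ∃ v : Fin 2 → ℂ, v ≠ 0 ∧ N.mulVec v = v := by
  obtain ⟨v, hv, h⟩ := Matrix.exists_mulVec_eq_zero_iff.mpr h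
  refine ⟨v, hv, ?_⟩
  rw [Matrix.sub_mulVec, Matrix.one_mulVec] at h
  exact sub_eq_zero.mp h

theorem not_cube_of_det {M : MM} (h : (-M - 1).det = 0) : M * M * M ≠ 1 := by
  intro h3
  obtain ⟨v, hv, h⟩ := fix_of_det h
  have h1 : M.mulVec v = -v := by
    rw [Matrix.neg_mulVec] at h
    rw [← neg_eq_iff_eq_neg]; exact h
  have h2 : (M * M * M).mulVec v = -v := by
    simp [← Matrix.mulVec_mulVec, h1, Matrix.mulVec_neg]
  rw [h3, Matrix.one_mulVec] at h2
  exact hv (self_eq_neg.mp h2)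

theorem not_cube_of_sq {M : MM} (h : M * M = -1) : M * M * M ≠ 1 := by
  intro h3
  have h4 : M = -1 := by
    rw [h] at h3
    rw [← h3]; simp
  rw [h4] at h
  have := congrFun (congrFun h 0) 0
  norm_num at this

theorem fix_of_inG {M : MM} (h : inG M) (h3 : M * M * M = 1) :
    ∃ v : Fin 2 → ℂ, v ≠ 0 ∧ M.mulVec v = v := by
  have key : (M - 1).det = 0 ∨ (-M - 1).det = 0 ∨ M * M = -1 := by
    have h1 := omega_sq
    have h2 := I_sq'
    obtain ⟨q, hq, h | h | h⟩ := h <;> subst h <;>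
    rcases hq with h | h | h | h | h | h | h | h <;> subst h
    · simp
    · simp
    iterate 6 simp [q_II, q_JJ, q_KK]
    all_goals
      try rw [tT_sq]
      try rw [tT_eq]
      rw [← or_assoc]
      left
      simp [Matrix.det_fin_two, I₂, qJ, qK]
      first
        | (left; grind)
        | (right; grind)
  rcases key with h | h | h
  · exact fix_of_det h
  · exact absurd h3 (not_cube_of_det h)
  · exact absurd h3 (not_cube_of_sq h)

theorem other_cube : (-I₂ * tT) * (-I₂ * tT) * (-I₂ * tT) = 1 := by
  have h1 := omega_sq
  have h2 := I_sq'
  rw [tT_eq]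
  ext i j
  fin_cases i <;> fin_cases j <;> simp [I₂, Matrix.mul_apply, Fin.sum_univ_two] <;> grind

theorem order_three_elements_are_reflections_and_generate
    (A₁ A₂ : GL (Fin 2) ℂ)
    (hA₁ : (A₁ : Matrix (Fin 2) (Fin 2) ℂ) = I₂)
    (hA₂ : (A₂ : Matrix (Fin 2) (Fin 2) ℂ) = ω • τ) :
    (∀ g ∈ Subgroup.closure {A₁, A₂}, orderOf g = 3 →
      ∃ v : Fin 2 → ℂ, v ≠ 0 ∧ (g : Matrix (Fin 2) (Fin 2) ℂ).mulVec v = v) ∧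
    Subgroup.closure
        {g : GL (Fin 2) ℂ | g ∈ Subgroup.closure {A₁, A₂} ∧ orderOf g = 3}
      = Subgroup.closure {A₁, A₂} := by
  change (A₂ : MM) = tT at hA₂
  have i1 : A₁⁻¹ = A₁ * A₁ * A₁ := by
    rw [inv_eq_iff_mul_eq_one]
    ext1
    simp only [Units.val_mul, hA₁, Units.val_one, q_II, ← Matrix.mul_assoc]
    simp [q_II]
  have i2 : A₂⁻¹ = A₂ * A₂ := by
    rw [inv_eq_iff_mul_eq_one, ← mul_assoc]
    ext1
    simp only [Units.val_mul, hA₂, Units.val_one, tT_cube]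
  have hI : ((A₁⁻¹ : GL (Fin 2) ℂ) : MM) = -I₂ := by
    rw [i1]
    simp [hA₁, q_II]
  constructor
  · intro g hg ho
    have hG : inG (g : MM) := by
      clear ho
      induction hg using Subgroup.closure_induction_right with
      | one => exact ⟨1, Or.inl rfl, Or.inl rfl⟩
      | mul_right x hx y hy ih =>
        rcases hy with rfl | rfl
        · rw [Units.val_mul, hA₁]
          exact inG_I ih
        · rw [Units.val_mul, hA₂]
          exact inG_T ih
      | mul_inv_cancel x hx y hy ih =>
        rcases hy with rfl | rfl
        · rw [i1]
          simp only [Units.val_mul, hA₁, ← Matrix.mul_assoc]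
          exact inG_I (inG_I (inG_I ih))
        · rw [i2]
          simp only [Units.val_mul, hA₂, ← Matrix.mul_assoc]
          exact inG_T (inG_T ih)
    apply fix_of_inG hG
    have h3 := pow_orderOf_eq_one g
    rw [ho, pow_succ, pow_two] at h3
    simpa using congrArg (fun u : GL (Fin 2) ℂ => (u : MM)) h3
  · have ord : ∀ g : GL (Fin 2) ℂ, g * g * g = 1 → g ≠ 1 → orderOf g = 3 := by
      intro g h h1
      haveI : Fact (Nat.Prime 3) := ⟨Nat.prime_three⟩
      exact orderOf_eq_prime (by rw [pow_succ, pow_two, h]) h1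
    have m1 : A₁ ∈ Subgroup.closure {A₁, A₂} := Subgroup.subset_closure (by simp)
    have m2 : A₂ ∈ Subgroup.closure {A₁, A₂} := Subgroup.subset_closure (by simp)
    have n2 : A₂ ≠ 1 := by
      rintro rfl
      have e : (1 : MM) = tT := by simpa using hA₂
      have h := tT_I
      rw [← e, Matrix.one_mul, Matrix.mul_one] at h
      have := congrFun (congrFun h 0) 0
      simp [I₂, qJ] at this
    have n1 : A₁⁻¹ * A₂ ≠ 1 := by
      intro h
      have e : A₁ = A₂ := inv_mul_eq_one.mp h
      have e' : I₂ = tT := by rw [← hA₁, ← hA₂, e]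
      have h := tT_I
      rw [← e', q_II, q_JI] at h
      have := congrFun (congrFun h 0) 0
      simp [qK] at this
    apply le_antisymm
    · rw [Subgroup.closure_le]
      exact fun g hg => hg.1
    · rw [Subgroup.closure_le]
      set C := Subgroup.closure
        {g : GL (Fin 2) ℂ | g ∈ Subgroup.closure {A₁, A₂} ∧ orderOf g = 3} with hC
      have c2 : A₂ ∈ C := by
        refine Subgroup.subset_closure ⟨m2, ord _ ?_ n2⟩
        ext1
        simp only [Units.val_mul, hA₂, Units.val_one, tT_cube]
      have c3 : A₁⁻¹ * A₂ ∈ C := by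
        refine Subgroup.subset_closure ⟨mul_mem (inv_mem m1) m2, ord _ ?_ n1⟩
        ext1
        simp only [Units.val_mul, hA₂, hI, Units.val_one, other_cube]
      have c1 : A₁ ∈ C := by
        have := mul_mem c2 (inv_mem c3)
        simpa using this
      intro g hg
      rcases hg with rfl | rfl
      · exact c1
      · exact c2

end
end

section
/- The ℂ-algebra R₂ = ℂ[a₁,a₃,a₄,a₅,a₆]/((a₅a₆ - 2q a₁)² + a₄(3q a₃ - a₆³)) is isomorphic as a ℂ-algebra to ℂ[u,v,w,s,t]/(u² + vw); that is, the chart U₂ of the blow-up Z₂' is a transversal A₁-singularity. -/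
/-!
STATEMENT 15: The ℂ-algebra
R₂ = ℂ[a₁,a₃,a₄,a₅,a₆]/((a₅a₆ - 2q a₁)² + a₄(3q a₃ - a₆³))
is isomorphic as a ℂ-algebra to ℂ[u,v,w,s,t]/(u² + vw); that is, the chart U₂ of
the blow-up Z₂' is a transversal A₁-singularity.
(Variables: a₁,a₃,a₄,a₅,a₆ = X 0,…,X 4 and u,v,w,s,t = X 0,…,X 4.)
-/

noncomputable section

open MvPolynomial

/-- q = 2ω+1, a square root of -3 -/
noncomputable def q : ℂ := 2 * ω + 1

theorem q_ne_zero_aux : q ≠ 0 := by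
  intro h
  have h3 : ω ^ 3 = 1 := by
    unfold ω
    rw [← Complex.exp_nat_mul, ← Complex.exp_two_pi_mul_I]
    congr 1
    push_cast
    ring
  have h1 : ω = -1 / 2 := by
    unfold q at h
    linear_combination h / 2
  rw [h1] at h3
  norm_num at h3

/-- The polynomial change of coordinates. -/
def coordChange : MvPolynomial (Fin 5) ℂ ≃ₐ[ℂ] MvPolynomial (Fin 5) ℂ :=
  AlgEquiv.ofAlgHom
    (aeval ![C (2 * q)⁻¹ * (X 3 * X 4 - X 0), C (3 * q)⁻¹ * (X 2 + X 4 ^ 3), X 1, X 3, X 4])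
    (aeval ![X 3 * X 4 - C (2 * q) * X 0, X 2, C (3 * q) * X 1 - X 4 ^ 3, X 3, X 4])
    (by
      have h2 : (C (2 * q) * C (2 * q)⁻¹ : MvPolynomial (Fin 5) ℂ) = 1 := by
        rw [← C_mul, mul_inv_cancel₀ (by simp [q_ne_zero_aux]), C_1]
      have h3 : (C (3 * q) * C (3 * q)⁻¹ : MvPolynomial (Fin 5) ℂ) = 1 := by
        rw [← C_mul, mul_inv_cancel₀ (by simp [q_ne_zero_aux]), C_1]
      generalize (2 * q)⁻¹ = a at *
      generalize (3 * q)⁻¹ = b at *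
      generalize 2 * q = c at *
      generalize 3 * q = d at *
      ext1 i
      fin_cases i <;> simp [algebraMap_eq]
      · linear_combination (-(X 3 * X 4 - X 0)) * h2
      · linear_combination (X 2 + X 4 ^ 3) * h3)
    (by
      have h2 : (C (2 * q) * C (2 * q)⁻¹ : MvPolynomial (Fin 5) ℂ) = 1 := by
        rw [← C_mul, mul_inv_cancel₀ (by simp [q_ne_zero_aux]), C_1]
      have h3 : (C (3 * q) * C (3 * q)⁻¹ : MvPolynomial (Fin 5) ℂ) = 1 := by
        rw [← C_mul, mul_inv_cancel₀ (by simp [q_ne_zero_aux]), C_1]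
      generalize (2 * q)⁻¹ = a at *
      generalize (3 * q)⁻¹ = b at *
      generalize 2 * q = c at *
      generalize 3 * q = d at *
      ext1 i
      fin_cases i <;> simp [algebraMap_eq]
      · linear_combination X 0 * h2
      · linear_combination X 1 * h3)

theorem coordChange_symm_eq :
    coordChange.symm (X 0 ^ 2 + X 1 * X 2) =
      (X 3 * X 4 - C (2 * q) * X 0) ^ 2 + X 2 * (C (3 * q) * X 1 - X 4 ^ 3) := by
  change aeval _ _ = _
  generalize 2 * q = c at *
  generalize 3 * q = d at *
  simp

theorem chart_U2_is_transversal_A1 :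
    Nonempty
      ((MvPolynomial (Fin 5) ℂ ⧸ Ideal.span
          {(X 3 * X 4 - C (2 * q) * X 0) ^ 2 + X 2 * (C (3 * q) * X 1 - X 4 ^ 3)})
        ≃ₐ[ℂ]
       (MvPolynomial (Fin 5) ℂ ⧸ Ideal.span
          ({X 0 ^ 2 + X 1 * X 2} : Set (MvPolynomial (Fin 5) ℂ)))) := by
  refine ⟨Ideal.quotientEquivAlg _ _ coordChange ?_⟩
  rw [← coordChange_symm_eq, Ideal.map_span, Set.image_singleton]
  congr 2
  exact (coordChange.apply_symm_apply _).symm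

end
end

section
/- In the polynomial ring ℂ[b₁,b₂,b₃,b₄,b₅,b₆], the radical of the ideal (b₁, b₃b₅, b₃b₄, b₅² - b₄b₆) equals the intersection of the two prime ideals (b₁, b₃, b₅² - b₄b₆) and (b₁, b₄, b₅); both ideals are prime, so the vanishing locus of (b₁, b₃b₅, b₃b₄, b₅² - b₄b₆) is the union of exactly two irreducible components (the fibre E of the resolution over the origin is the union of two irreducible surfaces). -/
/-!
STATEMENT 17: In ℂ[b₁,…,b₆], the radical of the ideal (b₁, b₃b₅, b₃b₄, b₅² - b₄b₆)
equals the intersection of the two prime ideals (b₁, b₃, b₅² - b₄b₆) and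
(b₁, b₄, b₅); both ideals are prime, and neither contains the other, so the
vanishing locus of (b₁, b₃b₅, b₃b₄, b₅² - b₄b₆) is the union of exactly two
irreducible components.  (Variables: b₁,…,b₆ = X 0,…,X 5.)
-/

open MvPolynomial

theorem isPrime_of_retract {R S : Type*} [CommRing R] [CommRing S] [IsDomain S]
    (I : Ideal R) (f : R →+* S) (g : S →+* R ⧸ I) (h1 : I ≤ RingHom.ker f)
    (h2 : g.comp f = Ideal.Quotient.mk I) : I.IsPrime := by
  have : I = RingHom.ker f := by
    refine le_antisymm h1 fun x hx => ?_
    rw [← Ideal.Quotient.eq_zero_iff_mem, ← h2, RingHom.comp_apply, RingHom.mem_ker.1 hx, map_zero]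
  rw [this]
  exact RingHom.ker_isPrime f

theorem prime_J2 : (Ideal.span {(X 0 : MvPolynomial (Fin 6) ℂ), X 3, X 4}).IsPrime := by
  set I := Ideal.span {(X 0 : MvPolynomial (Fin 6) ℂ), X 3, X 4} with hI
  let f : MvPolynomial (Fin 6) ℂ →ₐ[ℂ] MvPolynomial (Fin 6) ℂ := aeval ![0, X 1, X 2, 0, 0, X 5]
  have m0 : Ideal.Quotient.mk I (X 0) = 0 :=
    Ideal.Quotient.eq_zero_iff_mem.2 (Ideal.subset_span (by simp))
  have m3 : Ideal.Quotient.mk I (X 3) = 0 :=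
    Ideal.Quotient.eq_zero_iff_mem.2 (Ideal.subset_span (by simp))
  have m4 : Ideal.Quotient.mk I (X 4) = 0 :=
    Ideal.Quotient.eq_zero_iff_mem.2 (Ideal.subset_span (by simp))
  refine isPrime_of_retract I f.toRingHom (Ideal.Quotient.mk I) ?_ ?_
  · rw [hI, Ideal.span_le]
    rintro x (rfl | rfl | rfl) <;> simp [f, RingHom.mem_ker]
  · apply MvPolynomial.ringHom_ext
    · intro r
      simp [f, MvPolynomial.algebraMap_eq]
    · intro i
      fin_cases i <;> simp [f, m0, m3, m4]

theorem not_sq (a : MvPolynomial (Fin 6) ℂ) : a ^ 2 ≠ X 3 * X 5 := by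
  intro h
  have hp : Prime (X 3 : MvPolynomial (Fin 6) ℂ) := MvPolynomial.X_prime
  obtain ⟨b, rfl⟩ := hp.dvd_of_dvd_pow (h ▸ dvd_mul_right _ _ : X 3 ∣ a ^ 2)
  have h2 : X 3 * b ^ 2 = (X 5 : MvPolynomial (Fin 6) ℂ) := by
    apply mul_left_cancel₀ hp.ne_zero
    rw [← h]; ring
  have := congrArg (MvPolynomial.eval (![0, 0, 0, 0, 0, 1] : Fin 6 → ℂ)) h2
  simp at this

theorem prime_quad : Prime (Polynomial.X ^ 2 - Polynomial.C (X 3 * X 5 : MvPolynomial (Fin 6) ℂ)) := by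
  have hd := Polynomial.natDegree_X_pow_sub_C (n := 2) (r := (X 3 * X 5 : MvPolynomial (Fin 6) ℂ))
  have hm := Polynomial.monic_X_pow_sub_C (X 3 * X 5 : MvPolynomial (Fin 6) ℂ) two_ne_zero
  rw [← UniqueFactorizationMonoid.irreducible_iff_prime,
    hm.irreducible_iff_roots_eq_zero_of_degree_le_three (by rw [hd]) (by rw [hd]; norm_num)]
  rw [Multiset.eq_zero_iff_forall_notMem]
  intro a ha
  have := Polynomial.isRoot_of_mem_roots ha
  simp only [Polynomial.IsRoot, Polynomial.eval_sub, Polynomial.eval_pow, Polynomial.eval_X,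
    Polynomial.eval_C] at this
  exact not_sq a (sub_eq_zero.1 this)

theorem prime_J1 : (Ideal.span {(X 0 : MvPolynomial (Fin 6) ℂ), X 2,
    X 4 ^ 2 - X 3 * X 5}).IsPrime := by
  set I := Ideal.span {(X 0 : MvPolynomial (Fin 6) ℂ), X 2, X 4 ^ 2 - X 3 * X 5} with hI
  let q : Polynomial (MvPolynomial (Fin 6) ℂ) := Polynomial.X ^ 2 - Polynomial.C (X 3 * X 5)
  have m0 : Ideal.Quotient.mk I (X 0) = 0 :=
    Ideal.Quotient.eq_zero_iff_mem.2 (Ideal.subset_span (by simp))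
  have m2 : Ideal.Quotient.mk I (X 2) = 0 :=
    Ideal.Quotient.eq_zero_iff_mem.2 (Ideal.subset_span (by simp))
  have m4 : Ideal.Quotient.mk I (X 4 ^ 2 - X 3 * X 5) = 0 :=
    Ideal.Quotient.eq_zero_iff_mem.2 (Ideal.subset_span (by simp))
  have hdom : IsDomain (AdjoinRoot q) := AdjoinRoot.isDomain_of_prime prime_quad
  have hroot : AdjoinRoot.root q ^ 2 - AdjoinRoot.of q (X 3) * AdjoinRoot.of q (X 5) = 0 := by
    have := AdjoinRoot.eval₂_root q
    simpa [q] using this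
  let f : MvPolynomial (Fin 6) ℂ →+* AdjoinRoot q :=
    eval₂Hom ((AdjoinRoot.of q).comp C) ![0, AdjoinRoot.of q (X 1), 0, AdjoinRoot.of q (X 3),
      AdjoinRoot.root q, AdjoinRoot.of q (X 5)]
  let g : AdjoinRoot q →+* MvPolynomial (Fin 6) ℂ ⧸ I :=
    AdjoinRoot.lift (Ideal.Quotient.mk I) (Ideal.Quotient.mk I (X 4)) (by
      simpa [q] using m4)
  refine isPrime_of_retract I f g ?_ ?_
  · rw [hI, Ideal.span_le]
    rintro x (rfl | rfl | rfl)
    · simp [f, RingHom.mem_ker]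
    · simp [f, RingHom.mem_ker]
    · simpa [f, RingHom.mem_ker] using hroot
  · apply MvPolynomial.ringHom_ext
    · intro r
      simp [f, g]
    · intro i
      fin_cases i <;> simp [f, g, m0, m2]


theorem fibre_over_origin_two_components :
    (Ideal.span {(X 0 : MvPolynomial (Fin 6) ℂ),
        X 2 * X 4, X 2 * X 3, X 4 ^ 2 - X 3 * X 5}).radical
      = Ideal.span {(X 0 : MvPolynomial (Fin 6) ℂ), X 2, X 4 ^ 2 - X 3 * X 5}
        ⊓ Ideal.span {(X 0 : MvPolynomial (Fin 6) ℂ), X 3, X 4} ∧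
    (Ideal.span {(X 0 : MvPolynomial (Fin 6) ℂ), X 2,
        X 4 ^ 2 - X 3 * X 5}).IsPrime ∧
    (Ideal.span {(X 0 : MvPolynomial (Fin 6) ℂ), X 3, X 4}).IsPrime ∧
    ¬Ideal.span {(X 0 : MvPolynomial (Fin 6) ℂ), X 2, X 4 ^ 2 - X 3 * X 5}
        ≤ Ideal.span {(X 0 : MvPolynomial (Fin 6) ℂ), X 3, X 4} ∧
    ¬Ideal.span {(X 0 : MvPolynomial (Fin 6) ℂ), X 3, X 4}
        ≤ Ideal.span {(X 0 : MvPolynomial (Fin 6) ℂ), X 2, X 4 ^ 2 - X 3 * X 5} := by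
  have p1 := prime_J1
  have p2 := prime_J2
  refine ⟨le_antisymm ?_ ?_, p1, p2, ?_, ?_⟩
  · rw [Ideal.IsRadical.radical_le_iff (p1.isRadical.inf p2.isRadical), le_inf_iff,
      Ideal.span_le, Ideal.span_le]
    constructor
    · rintro x (rfl | rfl | rfl | rfl)
      · exact Ideal.subset_span (by simp)
      · exact Ideal.mul_mem_right _ _ (Ideal.subset_span (by simp))
      · exact Ideal.mul_mem_right _ _ (Ideal.subset_span (by simp))
      · exact Ideal.subset_span (by simp)
    · have h3 : (X 3 : MvPolynomial (Fin 6) ℂ) ∈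
          Ideal.span {(X 0 : MvPolynomial (Fin 6) ℂ), X 3, X 4} := Ideal.subset_span (by simp)
      have h4 : (X 4 : MvPolynomial (Fin 6) ℂ) ∈
          Ideal.span {(X 0 : MvPolynomial (Fin 6) ℂ), X 3, X 4} := Ideal.subset_span (by simp)
      rintro x (rfl | rfl | rfl | rfl)
      · exact Ideal.subset_span (by simp)
      · exact Ideal.mul_mem_left _ _ h4
      · exact Ideal.mul_mem_left _ _ h3
      · exact Ideal.sub_mem _ (Ideal.pow_mem_of_mem _ h4 2 (by norm_num))
          (Ideal.mul_mem_right _ _ h3)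
  · conv_lhs => rw [← p1.radical, ← p2.radical]
    rw [← Ideal.radical_mul]
    apply Ideal.radical_mono
    rw [Ideal.span_mul_span', Ideal.span_le]
    rintro _ ⟨x, (rfl | rfl | rfl), y, (rfl | rfl | rfl), rfl⟩
    · exact Ideal.mul_mem_right _ _ (Ideal.subset_span (by simp))
    · exact Ideal.mul_mem_right _ _ (Ideal.subset_span (by simp))
    · exact Ideal.mul_mem_right _ _ (Ideal.subset_span (by simp))
    · exact Ideal.mul_mem_left _ _ (Ideal.subset_span (by simp))
    · exact Ideal.subset_span (by simp)
    · exact Ideal.subset_span (by simp)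
    · exact Ideal.mul_mem_right _ _ (Ideal.subset_span (by simp))
    · exact Ideal.mul_mem_right _ _ (Ideal.subset_span (by simp))
    · exact Ideal.mul_mem_right _ _ (Ideal.subset_span (by simp))
  · intro h
    have h2 := h (Ideal.subset_span (by simp) : (X 2 : MvPolynomial (Fin 6) ℂ) ∈ _)
    have hk : Ideal.span {(X 0 : MvPolynomial (Fin 6) ℂ), X 3, X 4} ≤
        RingHom.ker (MvPolynomial.eval (![0, 0, 1, 0, 0, 0] : Fin 6 → ℂ)) := by
      rw [Ideal.span_le]
      rintro x (rfl | rfl | rfl) <;> simp [RingHom.mem_ker]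
    simpa [RingHom.mem_ker] using hk h2
  · intro h
    have h2 := h (Ideal.subset_span (by simp) : (X 3 : MvPolynomial (Fin 6) ℂ) ∈ _)
    have hk : Ideal.span {(X 0 : MvPolynomial (Fin 6) ℂ), X 2, X 4 ^ 2 - X 3 * X 5} ≤
        RingHom.ker (MvPolynomial.eval (![0, 0, 0, 1, 0, 0] : Fin 6 → ℂ)) := by
      rw [Ideal.span_le]
      rintro x (rfl | rfl | rfl) <;> simp [RingHom.mem_ker]
    simpa [RingHom.mem_ker] using hk h2
end
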